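/- Let n ≥ 2 and d ≥ 2, and let O be a linear operator on (ℂ^d)^{⊗n} with ‖O‖₂ = 1. Then H[O] ≤ 2·(log n + log d)·I[O] + h(P_O[0⃗]), where 0⃗ ∈ V^n denotes the all-(0,0) string. -/

import Mathlib

open Matrix Complex BigOperators
open scoped ComplexOrder
noncomputable section

namespace QC

/-- Operators on the `n`-qudit space `(ℂ^d)^{⊗n}`, as matrices indexed by
computational basis labels `Fin n → Fin d`. -/
abbrev QOp (d n : ℕ) := Matrix (Fin n → Fin d) (Fin n → Fin d) ℂ

/-- The qudit shift operator `X`, with `X|j⟩ = |j+1 mod d⟩`. -/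
def shiftX (d : ℕ) : Matrix (Fin d) (Fin d) ℂ :=
  fun i j => if (i : ℕ) = ((j : ℕ) + 1) % d then 1 else 0

/-- The qudit clock operator `Z`, with `Z|j⟩ = e^{2πij/d}|j⟩`. -/
def clockZ (d : ℕ) : Matrix (Fin d) (Fin d) ℂ :=
  Matrix.diagonal (fun j => Complex.exp (2 * Real.pi * Complex.I * (j : ℕ) / d))

/-- The single-qudit Pauli operator `P_a = X^s Z^t` for `a = (s,t) ∈ ℤ_d × ℤ_d`. -/
def pauli1 (d : ℕ) (a : ZMod d × ZMod d) : Matrix (Fin d) (Fin d) ℂ :=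
  shiftX d ^ a.1.val * clockZ d ^ a.2.val

/-- The `n`-qudit Pauli operator `P_ā = P_{a_1} ⊗ ⋯ ⊗ P_{a_n}`. -/
def pauliN (d n : ℕ) (a : Fin n → ZMod d × ZMod d) : QOp d n :=
  fun x y => ∏ i, pauli1 d (a i) (x i) (y i)

/-- The weight `|ā|`: the number of indices `i` with `a_i ≠ (0,0)`. -/
def weight (d n : ℕ) (a : Fin n → ZMod d × ZMod d) : ℕ :=
  (Finset.univ.filter (fun i => a i ≠ 0)).card

/-- `P_O[ā] = |Tr(O P_ā)|² / d^{2n}`. -/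
def pdist (d n : ℕ) (O : QOp d n) (a : Fin n → ZMod d × ZMod d) : ℝ :=
  ‖(O * pauliN d n a).trace‖ ^ 2 / (d : ℝ) ^ (2 * n)

/-- The normalized 2-norm `‖O‖₂ = (Tr(O†O)/d^n)^{1/2}`. -/
def l2norm (d n : ℕ) (O : QOp d n) : ℝ :=
  Real.sqrt (((Oᴴ * O).trace).re / (d : ℝ) ^ n)

/-- The total influence `I[O] = Σ_ā |ā|·P_O[ā]`. -/
def influence (d n : ℕ) [NeZero d] (O : QOp d n) : ℝ :=
  ∑ a : Fin n → ZMod d × ZMod d, (weight d n a : ℝ) * pdist d n O a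

/-- The local influence `I_j[O] = Σ_{ā : a_j ≠ 0} P_O[ā]`. -/
def localInfluence (d n : ℕ) [NeZero d] (j : Fin n) (O : QOp d n) : ℝ :=
  ∑ a ∈ Finset.univ.filter (fun a : Fin n → ZMod d × ZMod d => a j ≠ 0), pdist d n O a

/-- The quantum Fourier entropy `H[O] = -Σ_ā P_O[ā] log₂ P_O[ā]` (with `0·log 0 = 0`). -/
def qEntropy (d n : ℕ) [NeZero d] (O : QOp d n) : ℝ :=
  -∑ a : Fin n → ZMod d × ZMod d, pdist d n O a * Real.logb 2 (pdist d n O a)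

/-- The binary entropy `h(x) = -x log₂ x - (1-x) log₂ (1-x)`. -/
def binEntropy (x : ℝ) : ℝ :=
  -(x * Real.logb 2 x) - (1 - x) * Real.logb 2 (1 - x)

/-- Circuit sensitivity `CiS[U] = sup { |I[UOU†] - I[O]| : ‖O‖₂ = 1 }`. -/
def CiS (d n : ℕ) [NeZero d] (U : QOp d n) : ℝ :=
  sSup {x : ℝ | ∃ O : QOp d n, l2norm d n O = 1 ∧
    x = |influence d n (U * O * Uᴴ) - influence d n O|}

/-- Magic power `𝓜[U] = sup { |H[UOU†] - H[O]| : ‖O‖₂ = 1 }`. -/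
def magicPower (d n : ℕ) [NeZero d] (U : QOp d n) : ℝ :=
  sSup {x : ℝ | ∃ O : QOp d n, l2norm d n O = 1 ∧
    x = |qEntropy d n (U * O * Uᴴ) - qEntropy d n O|}

/-- Magic entropy `M[U] = max { H[U P_ā U†] : |ā| = 1 }`. -/
def magicEntropy (d n : ℕ) [NeZero d] (U : QOp d n) : ℝ :=
  sSup {x : ℝ | ∃ a : Fin n → ZMod d × ZMod d, weight d n a = 1 ∧
    x = qEntropy d n (U * pauliN d n a * Uᴴ)}

/-- The operator norm `‖A‖∞` (the L2 → L2 operator norm). -/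
def opNorm (d n : ℕ) (A : QOp d n) : ℝ :=
  ‖Matrix.toEuclideanCLM (𝕜 := ℂ) (n := Fin n → Fin d) A‖

/-- The influence rate `R_I(H,O)`. -/
def influenceRate (d n : ℕ) [NeZero d] (H O : QOp d n) : ℂ :=
  (Complex.I / (d : ℂ) ^ (2 * n)) * ∑ a : Fin n → ZMod d × ZMod d, (weight d n a : ℂ) *
    (((O * H - H * O) * pauliN d n a).trace * (O * (pauliN d n a)ᴴ).trace +
     ((O * H - H * O) * (pauliN d n a)ᴴ).trace * (O * pauliN d n a).trace)

/-- The magic rate `R_M(H,O)`. -/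
def magicRate (d n : ℕ) [NeZero d] (H O : QOp d n) : ℂ :=
  (Complex.I / (d : ℂ) ^ (2 * n)) * ∑ a : Fin n → ZMod d × ZMod d,
    (((O * H - H * O) * pauliN d n a).trace * (O * (pauliN d n a)ᴴ).trace +
     ((O * H - H * O) * (pauliN d n a)ᴴ).trace * (O * pauliN d n a).trace) *
    (Real.logb 2 (pdist d n O a) : ℂ)

/-- Extend an operator on the first `k` qudits by the identity: `H₀ ⊗ I`. -/
def extendOp (d k n : ℕ) (h : k ≤ n) (H0 : QOp d k) : QOp d n :=
  fun x y => if ∀ i : Fin n, k ≤ (i : ℕ) → x i = y i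
    then H0 (fun i => x (Fin.castLE h i)) (fun i => y (Fin.castLE h i)) else 0

/-- The tensor product `A ⊗ B` of an `n₁`-qudit and an `n₂`-qudit operator. -/
def tensorOp (d n₁ n₂ : ℕ) (A : QOp d n₁) (B : QOp d n₂) : QOp d (n₁ + n₂) :=
  fun x y => A (fun i => x (Fin.castAdd n₂ i)) (fun i => y (Fin.castAdd n₂ i)) *
             B (fun i => x (Fin.natAdd n₁ i)) (fun i => y (Fin.natAdd n₁ i))

/-- Embed a single-qudit operator `W` at position `j` (identity elsewhere). -/
def embedAt (d n : ℕ) (j : Fin n) (W : Matrix (Fin d) (Fin d) ℂ) : QOp d n :=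
  fun x y => if ∀ i, i ≠ j → x i = y i then W (x j) (y j) else 0

/-- The swap unitary exchanging qudits `i` and `j`. -/
def swapOp (d n : ℕ) (i j : Fin n) : QOp d n :=
  fun x y => if x = y ∘ Equiv.swap i j then 1 else 0

/-- The qubit Pauli X matrix. -/
def pauliX : Matrix (Fin 2) (Fin 2) ℂ := !![0, 1; 1, 0]

/-- The qubit Pauli Y matrix. -/
def pauliY : Matrix (Fin 2) (Fin 2) ℂ := !![0, -Complex.I; Complex.I, 0]

/-- The qubit Pauli Z matrix. -/
def pauliZ : Matrix (Fin 2) (Fin 2) ℂ := !![1, 0; 0, -1]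

/-- The ordered product `γ^S = ∏_{i∈S} γ_i` (factors in increasing index order). -/
def gammaProd (n : ℕ) (γ : Fin (2 * n) → QOp 2 n) (S : Finset (Fin (2 * n))) : QOp 2 n :=
  ((S.sort (· ≤ ·)).map γ).prod

/-- `P^G_O[S] = |Tr((γ^S)† O)|² / 2^{2n}`. -/
def pdistG (n : ℕ) (γ : Fin (2 * n) → QOp 2 n) (O : QOp 2 n) (S : Finset (Fin (2 * n))) : ℝ :=
  ‖((gammaProd n γ S)ᴴ * O).trace‖ ^ 2 / (2 : ℝ) ^ (2 * n)

/-- The Gaussian influence `I^G[O] = Σ_S |S|·P^G_O[S]`. -/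
def influenceG (n : ℕ) (γ : Fin (2 * n) → QOp 2 n) (O : QOp 2 n) : ℝ :=
  ∑ S : Finset (Fin (2 * n)), (S.card : ℝ) * pdistG n γ O S

/-- The Gaussian Fourier entropy `H^G[O] = -Σ_S P^G_O[S] log₂ P^G_O[S]`. -/
def entropyG (n : ℕ) (γ : Fin (2 * n) → QOp 2 n) (O : QOp 2 n) : ℝ :=
  -∑ S : Finset (Fin (2 * n)), pdistG n γ O S * Real.logb 2 (pdistG n γ O S)

/-- Gaussian circuit sensitivity `CiS^G[U] = sup { |I^G[UOU†] - I^G[O]| : ‖O‖₂ = 1 }`. -/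
def CiSG (n : ℕ) (γ : Fin (2 * n) → QOp 2 n) (U : QOp 2 n) : ℝ :=
  sSup {x : ℝ | ∃ O : QOp 2 n, l2norm 2 n O = 1 ∧
    x = |influenceG n γ (U * O * Uᴴ) - influenceG n γ O|}

/-- Fourier coefficient `f̂(S)` of a Boolean function `f : {-1,1}^n → ℝ`, with
the domain encoded as `Fin n → Bool` (`true ↦ -1`, `false ↦ 1`). -/
def fourierCoeff (n : ℕ) (f : (Fin n → Bool) → ℝ) (S : Finset (Fin n)) : ℝ :=
  (∑ x : Fin n → Bool, f x * ∏ i ∈ S, (if x i then -1 else 1)) / 2 ^ n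

/-- Fourier entropy of a Boolean function. -/
def boolEntropy (n : ℕ) (f : (Fin n → Bool) → ℝ) : ℝ :=
  -∑ S : Finset (Fin n), (fourierCoeff n f S) ^ 2 * Real.logb 2 ((fourierCoeff n f S) ^ 2)

/-- Total influence of a Boolean function. -/
def boolInfluence (n : ℕ) (f : (Fin n → Bool) → ℝ) : ℝ :=
  ∑ S : Finset (Fin n), (S.card : ℝ) * (fourierCoeff n f S) ^ 2

/-- The completely dephasing channel `Δ`. -/
def dephase (d n : ℕ) (A : QOp d n) : QOp d n :=
  Matrix.diagonal (fun i => A i i)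

/-- The diagonal matrix `log₂ Δ(ρ)` (entrywise base-2 logarithm of the diagonal). -/
def logDephase (d n : ℕ) (A : QOp d n) : QOp d n :=
  Matrix.diagonal (fun i => (Real.logb 2 (A i i).re : ℂ))

/-- The coherence rate `R_C(H,ρ) = -i Tr([ρ, log Δ(ρ)] H)`. -/
def cohRate (d n : ℕ) (H ρ : QOp d n) : ℂ :=
  -Complex.I * ((ρ * logDephase d n ρ - logDephase d n ρ * ρ) * H).trace

/-- The max-relative entropy `D_max(ρ‖σ) = log₂ min{λ > 0 : ρ ≤ λσ}`. -/
def Dmax (d n : ℕ) (ρ σ : QOp d n) : ℝ :=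
  Real.logb 2 (sInf {l : ℝ | 0 < l ∧ ((l : ℂ) • σ - ρ).PosSemidef})

/-! ### Completeness of the Pauli operators and Parseval's identity -/

lemma sum_zmod_val (d : ℕ) [NeZero d] {M : Type*} [AddCommMonoid M] (f : ℕ → M) :
    ∑ t : ZMod d, f t.val = ∑ t ∈ Finset.range d, f t := by
  obtain ⟨m, rfl⟩ := Nat.exists_eq_succ_of_ne_zero (NeZero.ne d)
  exact Fin.sum_univ_eq_sum_range f (m + 1)

lemma shiftX_pow_apply (d s : ℕ) (i j : Fin d) :
    (shiftX d ^ s) i j = if (i : ℕ) = ((j : ℕ) + s) % d then 1 else 0 := by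
  induction s generalizing i j with
  | zero =>
    simp [Matrix.one_apply, Nat.mod_eq_of_lt j.isLt, Fin.ext_iff]
  | succ s ih =>
    have hd : 0 < d := j.pos
    rw [pow_succ, Matrix.mul_apply, Finset.sum_eq_single ⟨((j : ℕ) + 1) % d, Nat.mod_lt _ hd⟩]
    · simp only [ih, shiftX, if_true, mul_one, Nat.mod_add_mod]
      rw [add_assoc, add_comm 1 s]
    · intro k _ hk
      have : (k : ℕ) ≠ ((j : ℕ) + 1) % d := fun h => hk (Fin.ext h)
      simp [shiftX, this]
    · simp

lemma pauli1_apply (d : ℕ) (a : ZMod d × ZMod d) (i j : Fin d) :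
    pauli1 d a i j = (if (i : ℕ) = ((j : ℕ) + a.1.val) % d then 1 else 0) *
      (Complex.exp (2 * Real.pi * Complex.I / d) ^ (j : ℕ)) ^ a.2.val := by
  have h : Complex.exp (2 * Real.pi * Complex.I * (j : ℕ) / d) =
      Complex.exp (2 * Real.pi * Complex.I / d) ^ (j : ℕ) := by
    rw [← Complex.exp_nat_mul]
    congr 1
    ring
  rw [pauli1, clockZ, Matrix.diagonal_pow, Matrix.mul_diagonal, shiftX_pow_apply, ← h]
  rfl

lemma sum_shift_indicator (d : ℕ) (i j k : Fin d) :
    ∑ s ∈ Finset.range d, (if (i : ℕ) = ((j : ℕ) + s) % d then (1 : ℂ) else 0) *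
      (if (k : ℕ) = ((j : ℕ) + s) % d then 1 else 0) = if i = k then 1 else 0 := by
  have hd : 0 < d := j.pos
  by_cases hik : i = k
  · subst hik
    rw [Finset.sum_eq_single (((i : ℕ) + (d - j)) % d)]
    · have : ((j : ℕ) + (i + (d - j)) % d) % d = i := by
        rw [Nat.add_mod_mod, show (j : ℕ) + (i + (d - j)) = i + d by omega, Nat.add_mod_right,
          Nat.mod_eq_of_lt i.isLt]
      simp [this]
    · intro s hs hne
      rw [if_neg, zero_mul]
      intro h
      apply hne
      rw [h, Nat.mod_add_mod, show (j : ℕ) + s + (d - j) = s + d by omega, Nat.add_mod_right,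
        Nat.mod_eq_of_lt (Finset.mem_range.1 hs)]
    · intro h
      exact absurd (Finset.mem_range.2 (Nat.mod_lt _ hd)) h
  · rw [if_neg hik]
    refine Finset.sum_eq_zero fun s _ => ?_
    by_cases h : (i : ℕ) = ((j : ℕ) + s) % d
    · have : (k : ℕ) ≠ ((j : ℕ) + s) % d := fun h' => hik (Fin.ext (h.trans h'.symm))
      simp [this]
    · simp [h]

lemma sum_clock_character (d : ℕ) [NeZero d] (j l : Fin d) :
    ∑ t ∈ Finset.range d, (Complex.exp (2 * Real.pi * Complex.I / d) ^ (j : ℕ)) ^ t *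
      star ((Complex.exp (2 * Real.pi * Complex.I / d) ^ (l : ℕ)) ^ t) =
      if j = l then (d : ℂ) else 0 := by
  have hζ := Complex.isPrimitiveRoot_exp d (NeZero.ne d)
  set ζ := Complex.exp (2 * Real.pi * Complex.I / d)
  have hstar : star ζ = ζ⁻¹ := by
    rw [Complex.inv_eq_conj (hζ.norm'_eq_one (NeZero.ne d))]
    rfl
  have hζ0 : ζ ≠ 0 := hζ.ne_zero (NeZero.ne d)
  have hterm : ∀ t, (ζ ^ (j : ℕ)) ^ t * star ((ζ ^ (l : ℕ)) ^ t) =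
      (ζ ^ (j : ℕ) * (ζ ^ (l : ℕ))⁻¹) ^ t := fun t => by
    rw [star_pow, star_pow, hstar, mul_pow, inv_pow]
  simp_rw [hterm]
  split_ifs with h
  · subst h
    simp [hζ0]
  · have hne : ζ ^ (j : ℕ) * (ζ ^ (l : ℕ))⁻¹ ≠ 1 := fun h1 => by
      rw [mul_inv_eq_one₀ (pow_ne_zero _ hζ0)] at h1
      exact h (Fin.ext (hζ.pow_inj j.isLt l.isLt h1))
    refine (mul_eq_zero.1 ?_).resolve_right (sub_ne_zero.2 hne)
    rw [geom_sum_mul, mul_pow, inv_pow, ← pow_mul, ← pow_mul, mul_comm (j : ℕ), mul_comm (l : ℕ),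
      pow_mul, pow_mul, hζ.pow_eq_one]
    simp

lemma pauli1_completeness (d : ℕ) [NeZero d] (i j k l : Fin d) :
    ∑ a : ZMod d × ZMod d, pauli1 d a i j * star (pauli1 d a k l) =
      if i = k ∧ j = l then (d : ℂ) else 0 := by
  have hfac : ∀ a : ZMod d × ZMod d, pauli1 d a i j * star (pauli1 d a k l) =
      ((if (i : ℕ) = ((j : ℕ) + a.1.val) % d then 1 else 0) *
        (if (k : ℕ) = ((l : ℕ) + a.1.val) % d then 1 else 0)) *
      ((Complex.exp (2 * Real.pi * Complex.I / d) ^ (j : ℕ)) ^ a.2.val *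
        star ((Complex.exp (2 * Real.pi * Complex.I / d) ^ (l : ℕ)) ^ a.2.val)) := fun a => by
    rw [pauli1_apply, pauli1_apply, star_mul', apply_ite star, star_one, star_zero]
    ring
  simp_rw [hfac]
  have hsplit : ∀ f g : ZMod d → ℂ,
      ∑ a : ZMod d × ZMod d, f a.1 * g a.2 = (∑ s, f s) * ∑ t, g t := fun f g => by
    rw [Fintype.sum_prod_type, Finset.sum_mul_sum]
  rw [hsplit (fun s => (if (i : ℕ) = ((j : ℕ) + s.val) % d then (1 : ℂ) else 0) *
      (if (k : ℕ) = ((l : ℕ) + s.val) % d then 1 else 0))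
      (fun t => (Complex.exp (2 * Real.pi * Complex.I / d) ^ (j : ℕ)) ^ t.val *
      star ((Complex.exp (2 * Real.pi * Complex.I / d) ^ (l : ℕ)) ^ t.val)),
    sum_zmod_val d (fun s => (if (i : ℕ) = ((j : ℕ) + s) % d then (1 : ℂ) else 0) *
      (if (k : ℕ) = ((l : ℕ) + s) % d then 1 else 0)),
    sum_zmod_val d (fun t => (Complex.exp (2 * Real.pi * Complex.I / d) ^ (j : ℕ)) ^ t *
      star ((Complex.exp (2 * Real.pi * Complex.I / d) ^ (l : ℕ)) ^ t)), sum_clock_character]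
  by_cases hjl : j = l
  · subst hjl
    rw [sum_shift_indicator]
    simp
  · simp [hjl]

lemma pauliN_completeness (d n : ℕ) [NeZero d] (x y z w : Fin n → Fin d) :
    ∑ a : Fin n → ZMod d × ZMod d, pauliN d n a x y * star (pauliN d n a z w) =
      if x = z ∧ y = w then (d : ℂ) ^ n else 0 := by
  have hprod : ∑ a : Fin n → ZMod d × ZMod d, pauliN d n a x y * star (pauliN d n a z w) =
      ∏ i, ∑ b : ZMod d × ZMod d, pauli1 d b (x i) (y i) * star (pauli1 d b (z i) (w i)) := by
    rw [Finset.prod_univ_sum, Fintype.piFinset_univ]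
    simp [pauliN, Finset.prod_mul_distrib]
  simp_rw [hprod, pauli1_completeness]
  split_ifs with h
  · obtain ⟨rfl, rfl⟩ := h
    simp
  · have : ∃ i, ¬ (x i = z i ∧ y i = w i) := by
      by_contra! hc
      exact h ⟨funext fun i => (hc i).1, funext fun i => (hc i).2⟩
    obtain ⟨i, hi⟩ := this
    exact Finset.prod_eq_zero (Finset.mem_univ i) (if_neg hi)

lemma sum_norm_sq_trace_mul_pauliN (d n : ℕ) [NeZero d] (O : QOp d n) :
    ∑ a : Fin n → ZMod d × ZMod d, ‖(O * pauliN d n a).trace‖ ^ 2 =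
      (d : ℝ) ^ n * ((Oᴴ * O).trace).re := by
  have htr : ∀ a, (O * pauliN d n a).trace =
      ∑ q : (Fin n → Fin d) × (Fin n → Fin d), O q.1 q.2 * pauliN d n a q.2 q.1 := fun a => by
    simp [Matrix.trace, Matrix.mul_apply, Fintype.sum_prod_type]
  have hsq : ∀ a, ((‖(O * pauliN d n a).trace‖ ^ 2 : ℝ) : ℂ) =
      ∑ q : (Fin n → Fin d) × (Fin n → Fin d), ∑ r : (Fin n → Fin d) × (Fin n → Fin d),
        O q.1 q.2 * star (O r.1 r.2) * (pauliN d n a q.2 q.1 * star (pauliN d n a r.2 r.1)) :=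
    fun a => by
    rw [Complex.ofReal_pow, ← Complex.mul_conj', htr, map_sum, Finset.sum_mul_sum]
    refine Finset.sum_congr rfl fun q _ => Finset.sum_congr rfl fun r _ => ?_
    rw [map_mul, ← starRingEnd_apply, ← starRingEnd_apply]
    ring
  have hO : ((d : ℂ) ^ n * (Oᴴ * O).trace) =
      ∑ q : (Fin n → Fin d) × (Fin n → Fin d), O q.1 q.2 * star (O q.1 q.2) * (d : ℂ) ^ n := by
    rw [Matrix.trace, Finset.mul_sum, Fintype.sum_prod_type_right]
    refine Finset.sum_congr rfl fun y _ => ?_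
    rw [Matrix.diag_apply, Matrix.mul_apply, Finset.mul_sum]
    refine Finset.sum_congr rfl fun x _ => ?_
    rw [Matrix.conjTranspose_apply]
    ring
  have key : ((∑ a : Fin n → ZMod d × ZMod d, ‖(O * pauliN d n a).trace‖ ^ 2 : ℝ) : ℂ) =
      (d : ℂ) ^ n * (Oᴴ * O).trace := by
    rw [hO, Complex.ofReal_sum]
    simp_rw [hsq]
    rw [Finset.sum_comm]
    refine Finset.sum_congr rfl fun q _ => ?_
    rw [Finset.sum_comm]
    simp_rw [← Finset.mul_sum, pauliN_completeness]
    rw [Finset.sum_eq_single q]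
    · simp
    · intro r _ hr
      rw [if_neg, mul_zero]
      rintro ⟨h2, h1⟩
      exact hr (Prod.ext h1.symm h2.symm)
    · simp
  have := congrArg Complex.re key
  rwa [Complex.ofReal_re, ← Complex.ofReal_natCast, ← Complex.ofReal_pow,
    Complex.re_ofReal_mul] at this

lemma pdist_nonneg (d n : ℕ) (O : QOp d n) (a : Fin n → ZMod d × ZMod d) :
    0 ≤ pdist d n O a := by
  unfold pdist
  positivity

lemma sum_pdist (d n : ℕ) [NeZero d] (O : QOp d n) (hO : l2norm d n O = 1) :
    ∑ a : Fin n → ZMod d × ZMod d, pdist d n O a = 1 := by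
  have hd : (d : ℝ) ≠ 0 := Nat.cast_ne_zero.2 (NeZero.ne d)
  rw [l2norm, Real.sqrt_eq_one, div_eq_one_iff_eq (pow_ne_zero _ hd)] at hO
  simp_rw [pdist]
  rw [← Finset.sum_div, sum_norm_sq_trace_mul_pauliN, hO, ← pow_add, two_mul,
    div_self (pow_ne_zero _ hd)]

/-! ### Entropy bounds -/

/-- The pointwise form of Gibbs' inequality. -/
lemma neg_mul_log_le {p q : ℝ} (hp : 0 ≤ p) (hq : 0 ≤ q) (h : q = 0 → p = 0) :
    -(p * Real.log p) ≤ -(p * Real.log q) + (q - p) := by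
  rcases hp.eq_or_lt with rfl | hp
  · simpa using hq
  have hq : 0 < q := hq.lt_of_ne' fun h0 => hp.ne' (h h0)
  have h1 := mul_le_mul_of_nonneg_left (Real.log_le_sub_one_of_pos (div_pos hq hp)) hp.le
  rw [Real.log_div hq.ne' hp.ne', mul_sub, mul_sub, mul_div_cancel₀ _ hp.ne'] at h1
  linarith

/-- The entropy of `p` splits off the binary entropy of the mass at `i₀`; the rest is bounded by
the cross entropy with any subprobability weight `r` on the complement of `i₀`. -/
lemma entropy_le_crossEntropy_add_binEntropy {ι : Type*} [Fintype ι] [DecidableEq ι]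
    (p r : ι → ℝ) (i₀ : ι) (hp : ∀ i, 0 ≤ p i) (hsum : ∑ i, p i = 1) (hr : ∀ i, 0 < r i)
    (hrsum : ∑ i ∈ Finset.univ.erase i₀, r i ≤ 1) :
    -∑ i, p i * Real.logb 2 (p i) ≤
      ∑ i ∈ Finset.univ.erase i₀, -(p i * Real.logb 2 (r i)) + binEntropy (p i₀) := by
  have hlog : 0 < Real.log 2 := Real.log_pos one_lt_two
  have hrest : ∑ i ∈ Finset.univ.erase i₀, p i = 1 - p i₀ := by
    rw [← hsum, ← Finset.add_sum_erase _ p (Finset.mem_univ i₀)]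
    ring
  set m := 1 - p i₀ with hm
  have hm0 : 0 ≤ m := hrest ▸ Finset.sum_nonneg fun i _ => hp i
  have hpm : ∀ i ∈ Finset.univ.erase i₀, m = 0 → p i = 0 := fun i hi h0 =>
    (Finset.sum_eq_zero_iff_of_nonneg fun i _ => hp i).1 (hrest.trans h0) i hi
  have hterm : ∀ i ∈ Finset.univ.erase i₀, -(p i * Real.log (p i)) ≤
      -(p i * Real.log (r i)) - p i * Real.log m + (m * r i - p i) := fun i hi => by
    have hmr : m * r i = 0 → p i = 0 := fun h =>
      hpm i hi ((mul_eq_zero.1 h).resolve_right (hr i).ne')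
    refine (neg_mul_log_le (hp i) (mul_nonneg hm0 (hr i).le) hmr).trans_eq ?_
    rcases eq_or_ne m 0 with h0 | h0
    · simp [hpm i hi h0]
    · rw [Real.log_mul h0 (hr i).ne']
      ring
  have hE := Finset.sum_le_sum hterm
  rw [Finset.sum_add_distrib, Finset.sum_sub_distrib, Finset.sum_sub_distrib, ← Finset.sum_mul,
    ← Finset.mul_sum, hrest] at hE
  have hmr : m * ∑ i ∈ Finset.univ.erase i₀, r i ≤ m := mul_le_of_le_one_right hm0 hrsum
  rw [← Finset.add_sum_erase _ _ (Finset.mem_univ i₀)]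
  simp only [binEntropy, Real.logb, ← mul_div_assoc, ← neg_div, ← Finset.sum_div, ← add_div,
    ← sub_div, ← hm]
  refine div_le_div_of_nonneg_right ?_ hlog.le
  rw [Finset.sum_neg_distrib] at hE
  linarith

lemma sum_pow_weight (d n : ℕ) [NeZero d] (c : ℝ) :
    ∑ a : Fin n → ZMod d × ZMod d, c ^ weight d n a = (1 + ((d : ℝ) ^ 2 - 1) * c) ^ n := by
  have hone : ∑ b : ZMod d × ZMod d, (if b ≠ 0 then c else 1) = 1 + ((d : ℝ) ^ 2 - 1) * c := by
    rw [← Finset.add_sum_erase _ _ (Finset.mem_univ (0 : ZMod d × ZMod d)),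
      Finset.sum_congr rfl fun b hb => if_pos (Finset.ne_of_mem_erase hb), Finset.sum_const,
      Finset.card_erase_of_mem (Finset.mem_univ _), Finset.card_univ, Fintype.card_prod,
      ZMod.card, nsmul_eq_mul, Nat.cast_sub (Nat.mul_pos (NeZero.pos d) (NeZero.pos d))]
    simp [sq]
  have hpow : ∀ a : Fin n → ZMod d × ZMod d,
      c ^ weight d n a = ∏ i, (if a i ≠ 0 then c else 1) := fun a => by
    rw [Finset.prod_ite, Finset.prod_const, Finset.prod_const_one, mul_one, weight]
  simp_rw [hpow]
  rw [← Fintype.piFinset_univ, ← Finset.prod_univ_sum (fun _ => Finset.univ)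
    (fun _ (b : ZMod d × ZMod d) => if b ≠ 0 then c else 1)]
  simp_rw [hone]
  simp

lemma one_add_pow_le_two {n d : ℕ} (hn : 2 ≤ n) (hd : 0 < d) :
    (1 + ((d : ℝ) ^ 2 - 1) * (((n : ℝ) * d) ^ 2)⁻¹) ^ n ≤ 2 := by
  have hn' : (2 : ℝ) ≤ n := by exact_mod_cast hn
  have hd' : (1 : ℝ) ≤ d := by exact_mod_cast hd
  have hbase : 1 + ((d : ℝ) ^ 2 - 1) * (((n : ℝ) * d) ^ 2)⁻¹ ≤ Real.exp (1 / (n : ℝ) ^ 2) := by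
    refine le_trans ?_ (Real.add_one_le_exp _)
    have : ((d : ℝ) ^ 2 - 1) * (((n : ℝ) * d) ^ 2)⁻¹ ≤ 1 / (n : ℝ) ^ 2 := by
      rw [← div_eq_mul_inv, div_le_div_iff₀ (by positivity) (by positivity)]
      nlinarith [sq_nonneg (n : ℝ)]
    linarith
  have hnonneg : 0 ≤ 1 + ((d : ℝ) ^ 2 - 1) * (((n : ℝ) * d) ^ 2)⁻¹ := by
    have : 0 ≤ (d : ℝ) ^ 2 - 1 := by nlinarith
    positivity
  calc _ ≤ Real.exp (1 / (n : ℝ) ^ 2) ^ n := pow_le_pow_left₀ hnonneg hbase n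
    _ = Real.exp (1 / n) := by
      rw [← Real.exp_nat_mul]
      congr 1
      field_simp
    _ ≤ Real.exp (Real.log 2) := by
      refine Real.exp_le_exp.2 (le_trans ?_ Real.log_two_gt_d9.le)
      calc 1 / (n : ℝ) ≤ 1 / 2 := one_div_le_one_div_of_le two_pos hn'
        _ ≤ _ := by norm_num
    _ = 2 := Real.exp_log two_pos

/-- **Weak quantum Fourier entropy–influence relation** (Theorem 3.1 / `thm:main1`):
for `n ≥ 2`, `d ≥ 2` and any operator `O` with `‖O‖₂ = 1`,
`H[O] ≤ 2 (log n + log d) I[O] + h(P_O[0⃗])`. -/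
theorem quantum_fourier_entropy_influence (n d : ℕ) (hn : 2 ≤ n) (hd : 2 ≤ d) [NeZero d]
    (O : QOp d n) (hO : l2norm d n O = 1) :
    qEntropy d n O ≤ 2 * (Real.logb 2 n + Real.logb 2 d) * influence d n O
      + binEntropy (pdist d n O 0) := by
  have hn0 : (0 : ℝ) < n := by exact_mod_cast (by omega : 0 < n)
  have hd0 : (0 : ℝ) < d := by exact_mod_cast (by omega : 0 < d)
  set c : ℝ := (((n : ℝ) * d) ^ 2)⁻¹ with hc
  have hweight : weight d n (0 : Fin n → ZMod d × ZMod d) = 0 := by simp [weight]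
  have hlogb : Real.logb 2 c = -(2 * (Real.logb 2 n + Real.logb 2 d)) := by
    rw [hc, Real.logb_inv, Real.logb_pow, Real.logb_mul hn0.ne' hd0.ne']
    norm_num
  have hsum : ∑ a ∈ Finset.univ.erase (0 : Fin n → ZMod d × ZMod d), c ^ weight d n a ≤ 1 := by
    have h := sum_pow_weight d n c
    rw [← Finset.add_sum_erase _ _ (Finset.mem_univ 0), hweight, pow_zero] at h
    have h2 : _ ≤ (2 : ℝ) := one_add_pow_le_two hn (NeZero.pos d)
    rw [← hc, ← h] at h2
    linarith
  refine (entropy_le_crossEntropy_add_binEntropy (pdist d n O) (fun a => c ^ weight d n a) 0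
    (pdist_nonneg d n O) (sum_pdist d n O hO) (fun a => by positivity) hsum).trans_eq ?_
  congr 1
  rw [influence, Finset.mul_sum, ← Finset.add_sum_erase _ _ (Finset.mem_univ 0), hweight,
    Nat.cast_zero, zero_mul, mul_zero, zero_add]
  refine Finset.sum_congr rfl fun a _ => ?_
  rw [Real.logb_pow, hlogb]
  ring

end QC
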